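/- Conjugation by Q puts the generators in normalized form: Q⁻¹ · I₂ · Q is the diagonal matrix diag(−1, 1, −1), and Q⁻¹ · (I₂I₃I₁I₃) · Q equals the lower triangular unipotent matrix [[1,0,0],[1,1,0],[−1/2,−1,1]]. -/

import Mathlib

open Matrix

/-- `s₀ = √(4√5 − 5)`. -/
noncomputable def s0 : ℝ := Real.sqrt (4 * Real.sqrt 5 - 5)

/-- `α₀ = −1 + (1+√5)(1 − i·s₀)/4`. -/
noncomputable def alpha0 : ℂ :=
  -1 + (1 + (Real.sqrt 5 : ℂ)) * (1 - Complex.I * (s0 : ℂ)) / 4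

/-- Generating complex reflections of the (3,3,5;∞)-triangle group. -/
noncomputable def I1 : Matrix (Fin 3) (Fin 3) ℂ :=
  !![1, -1, alpha0; 0, -1, 0; 0, 0, -1]

noncomputable def I2 : Matrix (Fin 3) (Fin 3) ℂ :=
  !![-1, 0, 0; -1, 1, -1; 0, 0, -1]

noncomputable def I3 : Matrix (Fin 3) (Fin 3) ℂ :=
  !![-1, 0, 0; 0, -1, 0; (starRingEnd ℂ) alpha0, -1, 1]

/-- The change-of-basis matrix `Q`. -/
noncomputable def Q : Matrix (Fin 3) (Fin 3) ℂ :=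
  !![(Real.sqrt 2 : ℂ) + (3 - (Real.sqrt 5 : ℂ)) * (-5 + Complex.I * (s0 : ℂ)) / (4 * (Real.sqrt 2 : ℂ)),
       0,
       -(Real.sqrt 2 : ℂ) + (1 + (Real.sqrt 5 : ℂ)) * (1 - Complex.I * (s0 : ℂ)) / (4 * (Real.sqrt 2 : ℂ));
     (2 + (2 - (Real.sqrt 5 : ℂ)) * (-3 + Complex.I * (s0 : ℂ))) / (4 * (Real.sqrt 2 : ℂ)),
       (Real.sqrt 2 : ℂ) / 2,
       -(Real.sqrt 2 : ℂ);
     (1 - (Real.sqrt 5 : ℂ)) * (-1 + Complex.I * (s0 : ℂ)) / (4 * (Real.sqrt 2 : ℂ)),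
       0,
       -(Real.sqrt 2 : ℂ) + (1 + (Real.sqrt 5 : ℂ)) * (-1 + Complex.I * (s0 : ℂ)) / (4 * (Real.sqrt 2 : ℂ))]

/-- The matrix `4√2 • Q`, with `f` in place of `√5` and `w` in place of `i·s₀`. -/
def scaledQ (f w : ℂ) : Matrix (Fin 3) (Fin 3) ℂ :=
  !![8 + (3 - f) * (-5 + w), 0, -8 + (1 + f) * (1 - w);
     2 + (2 - f) * (-3 + w), 4, -8;
     (1 - f) * (-1 + w), 0, -8 + (1 + f) * (-1 + w)]

theorem ofReal_sqrt_sq {x : ℝ} (hx : 0 ≤ x) : ((Real.sqrt x : ℝ) : ℂ) ^ 2 = x := by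
  rw [← Complex.ofReal_pow, Real.sq_sqrt hx]

theorem sqrt_five_sq : (Real.sqrt 5 : ℂ) ^ 2 = 5 := by
  simpa using ofReal_sqrt_sq (x := 5) (by norm_num)

theorem I_mul_s0_sq : (Complex.I * (s0 : ℂ)) ^ 2 = 5 - 4 * (Real.sqrt 5 : ℂ) := by
  have h : (0 : ℝ) ≤ 4 * Real.sqrt 5 - 5 := by
    have : (2 : ℝ) ≤ Real.sqrt 5 := Real.le_sqrt_of_sq_le (by norm_num)
    linarith
  rw [mul_pow, Complex.I_sq, s0, ofReal_sqrt_sq h]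
  push_cast
  ring

theorem conj_alpha0 : (starRingEnd ℂ) alpha0 =
    -1 + (1 + (Real.sqrt 5 : ℂ)) * (1 + Complex.I * (s0 : ℂ)) / 4 := by
  simp [alpha0, Complex.conj_ofNat]

theorem Q_eq_smul_scaledQ :
    Q = (4 * (Real.sqrt 2 : ℂ))⁻¹ • scaledQ (Real.sqrt 5) (Complex.I * s0) := by
  have hr : (Real.sqrt 2 : ℂ) ^ 2 = 2 := by
    simpa using ofReal_sqrt_sq (x := 2) (by norm_num)
  have h0 : (Real.sqrt 2 : ℂ) ≠ 0 := by
    rintro h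
    simp [h] at hr
  ext i j
  fin_cases i <;> fin_cases j <;> simp [Q, scaledQ] <;> field_simp <;> grind

theorem isUnit_det_scaledQ {f w : ℂ} (hf : f ^ 2 = 5) (hw : w ^ 2 = 5 - 4 * f) :
    IsUnit (scaledQ f w).det := by
  refine IsUnit.of_mul_eq_one (-(3 - w + 5 * f + f * w) / 2048) ?_
  simp [scaledQ, Matrix.det_fin_three]
  grind

theorem isUnit_det_Q : IsUnit Q.det := by
  rw [Q_eq_smul_scaledQ, Matrix.det_smul]
  refine IsUnit.mul ?_ (isUnit_det_scaledQ sqrt_five_sq I_mul_s0_sq)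
  simp

theorem I2_mul_Q : I2 * Q = Q * Matrix.diagonal ![-1, 1, -1] := by
  rw [Q_eq_smul_scaledQ, Matrix.mul_smul, Matrix.smul_mul]
  congr 1
  have hf := sqrt_five_sq
  have hw := I_mul_s0_sq
  generalize (Real.sqrt 5 : ℂ) = f at *
  generalize Complex.I * (s0 : ℂ) = w at *
  ext i j
  fin_cases i <;> fin_cases j <;>
    simp [I2, scaledQ, Matrix.mul_apply, Fin.sum_univ_three] <;> grind

theorem I2_mul_I3_mul_I1_mul_I3_mul_Q :
    I2 * I3 * I1 * I3 * Q = Q * !![1, 0, 0; 1, 1, 0; -1/2, -1, 1] := by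
  rw [Q_eq_smul_scaledQ, Matrix.mul_smul, Matrix.smul_mul]
  congr 1
  rw [I3, conj_alpha0, I1, alpha0]
  have hf := sqrt_five_sq
  have hw := I_mul_s0_sq
  generalize (Real.sqrt 5 : ℂ) = f at *
  generalize Complex.I * (s0 : ℂ) = w at *
  ext i j
  fin_cases i <;> fin_cases j <;>
    simp [I2, scaledQ, Matrix.mul_apply, Fin.sum_univ_three] <;> grind

theorem Q_normalizes_generators :
    Q⁻¹ * I2 * Q = Matrix.diagonal ![-1, 1, -1] ∧
    Q⁻¹ * (I2 * I3 * I1 * I3) * Q = !![1, 0, 0; 1, 1, 0; -1/2, -1, 1] := by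
  constructor
  · rw [Matrix.mul_assoc, I2_mul_Q, Matrix.nonsing_inv_mul_cancel_left _ _ isUnit_det_Q]
  · rw [Matrix.mul_assoc, I2_mul_I3_mul_I1_mul_I3_mul_Q,
      Matrix.nonsing_inv_mul_cancel_left _ _ isUnit_det_Q]
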